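/- arXiv:math/0604323 — 2 statements merged into one kernel-verified Lean document; each statement's English description precedes it below -/
import Mathlib

section
/- Assume n ≥ 2. Let h ∈ GL(E) be a linear automorphism such that for every 2-dimensional isotropic subspace V of E the image h(V) is again isotropic. Then there exists λ ∈ ℂ* such that ω(hu, hv) = λ·ω(u, v) for all u, v ∈ E; consequently, if μ ∈ ℂ* satisfies μ² = λ^{−1}, then μh belongs to the odd symplectic group Sp_{2n+1}(ω). -/
open Module Submodule

/-- An alternating form `B` vanishing wherever the alternating form `ω ≠ 0` vanishes is a scalar
multiple of `ω`. -/
theorem LinearMap.BilinForm.IsAlt.exists_eq_mul_of_forall_eq_zero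
    {K E : Type*} [Field K] [AddCommGroup E] [Module K E] {ω B : LinearMap.BilinForm K E}
    (hω : ω.IsAlt) (hB : B.IsAlt) (hω0 : ω ≠ 0) (hωB : ∀ u v, ω u v = 0 → B u v = 0) :
    ∃ c : K, ∀ u v, B u v = c * ω u v := by
  have cross (u v w : E) : ω u w * B u v = ω u v * B u w := by
    have := hωB u (ω u w • v - ω u v • w) (by simp [mul_comm])
    simpa [sub_eq_zero] using this
  have ratio_right (u v w : E) (hv : ω u v ≠ 0) (hw : ω u w ≠ 0) :
      B u v / ω u v = B u w / ω u w := by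
    rw [div_eq_div_iff hv hw]
    linear_combination cross u v w
  have ratio_swap (u v : E) : B u v / ω u v = B v u / ω v u := by
    rw [← hB.neg_eq, ← hω.neg_eq, neg_div_neg_eq]
  obtain ⟨a, b, hab⟩ : ∃ a b, ω a b ≠ 0 := by
    by_contra! hall
    exact hω0 (LinearMap.ext₂ hall)
  refine ⟨B a b / ω a b, fun u v => ?_⟩
  by_cases huv : ω u v = 0
  · rw [huv, hωB u v huv, mul_zero]
  obtain ⟨w, haw, huw⟩ : ∃ w, ω a w ≠ 0 ∧ ω u w ≠ 0 := by
    by_cases hub : ω u b = 0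
    · by_cases hav : ω a v = 0
      · exact ⟨b + v, by simpa [hav], by simpa [hub]⟩
      · exact ⟨v, hav, huv⟩
    · exact ⟨b, hab, hub⟩
  have swap_ne {x y : E} (hxy : ω x y ≠ 0) : ω y x ≠ 0 := by
    rwa [← hω.neg_eq, neg_ne_zero]
  rw [ratio_right a b w hab haw, ratio_swap a w, ratio_right w a u (swap_ne haw) (swap_ne huw),
    ratio_swap w u, ratio_right u w v huw huv, div_mul_cancel₀ _ huv]

/-- (`n ≥ 2`.)  If a linear automorphism `h` of `E` maps every
`2`-dimensional isotropic subspace of `E` to an isotropic subspace, then there is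
`λ ∈ ℂ*` with `ω(hu, hv) = λ·ω(u, v)` for all `u, v ∈ E`; consequently, for any
`μ ∈ ℂ*` with `μ² = λ⁻¹`, the automorphism `μh` preserves `ω`, i.e. belongs to the odd
symplectic group `Sp_{2n+1}(ω)`. -/
theorem isotropic_preserving_is_conformal
    {E : Type*} [AddCommGroup E] [Module ℂ E] [FiniteDimensional ℂ E]
    (n : ℕ) (hn : 2 ≤ n) (hdim : finrank ℂ E = 2 * n + 1)
    (ω : LinearMap.BilinForm ℂ E) (halt : ω.IsAlt)
    (hker : finrank ℂ (LinearMap.ker ω) = 1)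
    (h : E ≃ₗ[ℂ] E)
    (hiso : ∀ V : Submodule ℂ E, finrank ℂ V = 2 →
      (∀ x ∈ V, ∀ y ∈ V, ω x y = 0) →
      (∀ x ∈ Submodule.map (h : E →ₗ[ℂ] E) V, ∀ y ∈ Submodule.map (h : E →ₗ[ℂ] E) V,
        ω x y = 0)) :
    ∃ lam : ℂˣ,
      (∀ u v : E, ω (h u) (h v) = (lam : ℂ) * ω u v) ∧
      (∀ mu : ℂ, mu ^ 2 = ((lam : ℂ))⁻¹ →
        ∀ u v : E, ω (mu • h u) (mu • h v) = ω u v) := by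
  have hω0 : ω ≠ 0 := by
    rintro rfl
    rw [LinearMap.ker_zero, finrank_top] at hker
    omega
  have hvanish (u v : E) (huv : ω u v = 0) : ω (h u) (h v) = 0 := by
    by_cases hli : LinearIndependent ℂ ![u, v]
    · refine hiso (span ℂ {u, v}) ?_ ?_ _ (mem_map_of_mem (subset_span (by simp))) _
        (mem_map_of_mem (subset_span (by simp)))
      · rw [← Matrix.range_cons_cons_empty u v ![], finrank_span_eq_card hli, Fintype.card_fin]
      · intro x hx y hy
        obtain ⟨a, b, rfl⟩ := mem_span_pair.1 hx
        obtain ⟨c, d, rfl⟩ := mem_span_pair.1 hy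
        have hvu : ω v u = 0 := by rw [← halt.neg_eq, huv, neg_zero]
        simp [huv, hvu, halt u, halt v]
    · rw [LinearIndependent.pair_iff] at hli
      push Not at hli
      obtain ⟨s, t, hst, hne⟩ := hli
      have hst' : s • h u + t • h v = 0 := by simpa using congrArg h hst
      by_cases hs : s = 0
      · have ht := hne hs
        have : h v = 0 := by simpa [hs, ht] using hst'
        simp [this]
      · have := congrArg (fun x => ω x (h v)) hst'
        simpa [halt (h v), hs] using this
  let B : LinearMap.BilinForm ℂ E := ω.compl₁₂ (h : E →ₗ[ℂ] E) (h : E →ₗ[ℂ] E)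
  obtain ⟨c, hc⟩ := halt.exists_eq_mul_of_forall_eq_zero (B := B) (fun u => halt (h u)) hω0 hvanish
  replace hc (u v : E) : ω (h u) (h v) = c * ω u v := hc u v
  have hc0 : c ≠ 0 := by
    rintro rfl
    refine hω0 (LinearMap.ext₂ fun u v => ?_)
    simpa using hc (h.symm u) (h.symm v)
  refine ⟨Units.mk0 c hc0, hc, fun mu hmu u v => ?_⟩
  rw [Units.val_mk0] at hmu
  calc ω (mu • h u) (mu • h v) = mu ^ 2 * (c * ω u v) := by simp [hc]; ring
    _ = ω u v := by rw [hmu, inv_mul_cancel_left₀ hc0]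
end

section
/- Fix 2 ≤ k ≤ n. For every nonzero vector v ∈ E, the line ℂv equals the intersection of all k-dimensional isotropic subspaces of E containing v; in particular every line of E is contained in at least two distinct k-dimensional isotropic subspaces. -/
open Module Submodule

theorem Submodule.mem_sup_span_singleton {R M : Type*} [Ring R] [AddCommGroup M] [Module R M]
    {p : Submodule R M} {x y : M} :
    x ∈ p ⊔ span R {y} ↔ ∃ a ∈ p, ∃ r : R, a + r • y = x := by
  simp [mem_sup, mem_span_singleton]

/-- An isotropic subspace of dimension `d` with `2 * d + 1 < dim E` that avoids `w` can be enlarged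
by one dimension to an isotropic subspace that still avoids `w`. -/
theorem exists_isotropic_finrank_succ_notMem {K E : Type*} [Field K] [AddCommGroup E] [Module K E]
    [FiniteDimensional K E] {ω : LinearMap.BilinForm K E} (halt : ω.IsAlt) {W : Submodule K E}
    (hdim : 2 * finrank K W + 1 < finrank K E) (hW : ∀ x ∈ W, ∀ y ∈ W, ω x y = 0)
    {w : E} (hw : w ∉ W) :
    ∃ W' : Submodule K E, W ≤ W' ∧ finrank K W' = finrank K W + 1 ∧
      (∀ x ∈ W', ∀ y ∈ W', ω x y = 0) ∧ w ∉ W' := by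
  let φ : E →ₗ[K] Dual K W := W.subtype.dualMap ∘ₗ ω
  have hrank : finrank K E ≤ finrank K W + finrank K (LinearMap.ker φ) := by
    rw [← LinearMap.finrank_range_add_finrank_ker φ, ← Subspace.dual_finrank_eq (V := W)]
    exact Nat.add_le_add_right (Submodule.finrank_le _) _
  obtain ⟨u, hu, huW⟩ : ∃ u ∈ LinearMap.ker φ, u ∉ W ⊔ span K {w} := by
    by_contra! h
    have h₁ := Submodule.finrank_mono (show LinearMap.ker φ ≤ W ⊔ span K {w} from h)
    have h₂ := Submodule.finrank_add_le_finrank_add_finrank W (span K {w})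
    have h₃ : finrank K (span K {w}) ≤ 1 := (finrank_span_le_card {w}).trans (by simp)
    omega
  have hωu : ∀ y ∈ W, ω u y = 0 := fun y hy ↦ LinearMap.congr_fun hu (⟨y, hy⟩ : W)
  have hu' : u ∉ W := fun h ↦ huW (mem_sup_left h)
  refine ⟨W ⊔ span K {u}, le_sup_left, finrank_sup_span_singleton hu', ?_, ?_⟩
  · intro x hx y hy
    obtain ⟨a, ha, r, rfl⟩ := mem_sup_span_singleton.1 hx
    obtain ⟨b, hb, s, rfl⟩ := mem_sup_span_singleton.1 hy
    have hau : ω a u = 0 := halt.isRefl u a (hωu a ha)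
    simp [hW a ha b hb, hωu b hb, hau, halt.self_eq_zero u]
  · intro h
    obtain ⟨a, ha, r, har⟩ := mem_sup_span_singleton.1 h
    have hr : r ≠ 0 := by
      rintro rfl
      apply hw
      rw [← har]
      simpa using ha
    apply huW
    refine mem_sup_span_singleton.2 ⟨-(r⁻¹ • a), neg_mem (W.smul_mem _ ha), r⁻¹, ?_⟩
    rw [← har, smul_add, inv_smul_smul₀ hr, neg_add_cancel_left]

/-- If `w` is not on the line spanned by `v ≠ 0`, then in each dimension `1 ≤ k` with
`2 * k < dim E` there is an isotropic subspace containing `v` but not `w`. -/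
theorem exists_isotropic_finrank_eq_mem_notMem {K E : Type*} [Field K] [AddCommGroup E]
    [Module K E] [FiniteDimensional K E] {ω : LinearMap.BilinForm K E} (halt : ω.IsAlt)
    {v w : E} (hv : v ≠ 0) (hw : w ∉ span K {v}) {k : ℕ} (hk : 1 ≤ k)
    (hdim : 2 * k < finrank K E) :
    ∃ V : Submodule K E, finrank K V = k ∧ (∀ x ∈ V, ∀ y ∈ V, ω x y = 0) ∧ v ∈ V ∧ w ∉ V := by
  induction k, hk using Nat.le_induction with
  | base =>
    refine ⟨span K {v}, finrank_span_singleton hv, ?_, mem_span_singleton_self v, hw⟩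
    intro x hx y hy
    obtain ⟨r, rfl⟩ := mem_span_singleton.1 hx
    obtain ⟨s, rfl⟩ := mem_span_singleton.1 hy
    simp [halt.self_eq_zero v]
  | succ d _ ih =>
    obtain ⟨W, hWd, hW, hvW, hwW⟩ := ih (by omega)
    obtain ⟨W', hle, hfr, hiso, hnot⟩ :=
      exists_isotropic_finrank_succ_notMem halt (by omega) hW hwW
    exact ⟨W', by omega, hiso, hle hvW, hnot⟩

/-- A subspace of dimension at least two is not contained in a line. -/
theorem exists_mem_notMem_span_singleton {K E : Type*} [Field K] [AddCommGroup E] [Module K E]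
    [FiniteDimensional K E] {V : Submodule K E} (hV : 2 ≤ finrank K V) (v : E) :
    ∃ w ∈ V, w ∉ span K {v} := by
  by_contra! h
  have h₁ := Submodule.finrank_mono (show V ≤ span K {v} from h)
  have h₂ : finrank K (span K {v}) ≤ 1 := (finrank_span_le_card {v}).trans (by simp)
  omega

/-- (`2 ≤ k ≤ n`, `n ≥ 2`.)  For every nonzero vector `v ∈ E` the line
`ℂv` equals the intersection of all `k`-dimensional isotropic subspaces of `E`
containing `v`; in particular every line of `E` is contained in at least two distinct
`k`-dimensional isotropic subspaces. -/
theorem line_is_intersection_of_isotropic_subspaces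
    {E : Type*} [AddCommGroup E] [Module ℂ E] [FiniteDimensional ℂ E]
    (n k : ℕ) (hn : 2 ≤ n) (hk2 : 2 ≤ k) (hkn : k ≤ n)
    (hdim : finrank ℂ E = 2 * n + 1)
    (ω : LinearMap.BilinForm ℂ E) (halt : ω.IsAlt)
    (hker : finrank ℂ (LinearMap.ker ω) = 1) :
    ∀ v : E, v ≠ 0 →
      (Submodule.span ℂ {v} =
        sInf {V : Submodule ℂ E | finrank ℂ V = k ∧
          (∀ x ∈ V, ∀ y ∈ V, ω x y = 0) ∧ v ∈ V}) ∧
      (∃ V₁ V₂ : Submodule ℂ E, V₁ ≠ V₂ ∧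
        (finrank ℂ V₁ = k ∧ (∀ x ∈ V₁, ∀ y ∈ V₁, ω x y = 0) ∧
          Submodule.span ℂ {v} ≤ V₁) ∧
        (finrank ℂ V₂ = k ∧ (∀ x ∈ V₂, ∀ y ∈ V₂, ω x y = 0) ∧
          Submodule.span ℂ {v} ≤ V₂)) := by
  intro v hv
  have key {w : E} (hw : w ∉ span ℂ {v}) :=
    exists_isotropic_finrank_eq_mem_notMem halt hv hw (k := k) (by omega) (by omega)
  constructor
  · apply le_antisymm
    · exact le_sInf fun V hV ↦ (span_singleton_le_iff_mem v V).2 hV.2.2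
    · intro w hw
      by_contra hwv
      obtain ⟨V, hVk, hV, hvV, hwV⟩ := key hwv
      exact hwV (mem_sInf.1 hw V ⟨hVk, hV, hvV⟩)
  · obtain ⟨w₁, -, hw₁⟩ := exists_mem_notMem_span_singleton (K := ℂ) (V := (⊤ : Submodule ℂ E))
      (by rw [finrank_top]; omega) v
    obtain ⟨V₁, hk₁, hV₁, hv₁, -⟩ := key hw₁
    obtain ⟨w₂, hw₂, hw₂v⟩ := exists_mem_notMem_span_singleton (hk2.trans_eq hk₁.symm) v
    obtain ⟨V₂, hk₂, hV₂, hv₂, hw₂V⟩ := key hw₂v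
    refine ⟨V₁, V₂, ?_, ⟨hk₁, hV₁, (span_singleton_le_iff_mem v V₁).2 hv₁⟩,
      hk₂, hV₂, (span_singleton_le_iff_mem v V₂).2 hv₂⟩
    rintro rfl
    exact hw₂V hw₂
end
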